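/- arXiv:1005.1419 — 5 statements merged into one kernel-verified Lean document; each statement's English description precedes it below -/
import Mathlib

section
/- For every initial value w₀ ∈ ℂ² there exists a unique function w : ℝ → ℂ² such that w(0) = w₀, w is differentiable at every t ∈ ℝ, and w solves the (p,q)-twisted SL system at every t ∈ ℝ. In particular, solutions of the initial value problem exist globally in time and are unique. -/
open Set Filter Topology Metric
open scoped NNReal

/-- A bounded Lipschitz autonomous vector field on a Banach space has a global integral curve
through every point. -/
theorem exists_forall_hasDerivAt_of_lipschitzWith_of_bounded {E : Type*} [NormedAddCommGroup E]
    [NormedSpace ℝ E] [CompleteSpace E] {V : E → E} {K L : ℝ≥0} (hV : LipschitzWith K V)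
    (hL : ∀ x, ‖V x‖ ≤ L) (x₀ : E) :
    ∃ γ : ℝ → E, γ 0 = x₀ ∧ ∀ t, HasDerivAt γ (V (γ t)) t := by
  have hloc (n : ℕ) : ∃ γ : ℝ → E, γ 0 = x₀ ∧
      ∀ t ∈ Ioo (-(n + 1 : ℝ)) (n + 1), HasDerivAt γ (V (γ t)) t := by
    have h0 : (0 : ℝ) ∈ Icc (-(n + 1 : ℝ)) (n + 1) := ⟨by linarith, by positivity⟩
    have hPL : IsPicardLindelof (fun _ ↦ V) ⟨0, h0⟩ x₀ (L * (n + 1)) 0 L K :=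
      .of_time_independent (fun x _ ↦ hL x) hV.lipschitzOnWith (by simp)
    obtain ⟨γ, hγ, hγ'⟩ := hPL.exists_eq_forall_mem_Icc_hasDerivWithinAt₀
    exact ⟨γ, hγ, fun t ht ↦ (hγ' t (Ioo_subset_Icc_self ht)).hasDerivAt
      (Icc_mem_nhds ht.1 ht.2)⟩
  choose γ hγ0 hγ using hloc
  have hmono {m n : ℕ} (hmn : m ≤ n) : EqOn (γ m) (γ n) (Ioo (-(m + 1 : ℝ)) (m + 1)) := by
    have hmn' : (m : ℝ) ≤ n := by exact_mod_cast hmn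
    refine ODE_solution_unique_of_mem_Ioo (v := fun _ ↦ V) (s := fun _ ↦ univ) (K := K) (t₀ := 0)
      (fun _ _ ↦ hV.lipschitzOnWith) ⟨by linarith [m.cast_nonneg (α := ℝ)], by positivity⟩
      (fun t ht ↦ ⟨hγ m t ht, mem_univ _⟩)
      (fun t ht ↦ ⟨hγ n t ⟨by linarith [ht.1], by linarith [ht.2]⟩, mem_univ _⟩)
      ((hγ0 m).trans (hγ0 n).symm)
  have hmem (t : ℝ) : t ∈ Ioo (-(⌈|t|⌉₊ + 1 : ℝ)) (⌈|t|⌉₊ + 1) :=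
    abs_lt.mp ((Nat.le_ceil |t|).trans_lt (lt_add_one _))
  have heq (n : ℕ) : EqOn (fun t ↦ γ ⌈|t|⌉₊ t) (γ n) (Ioo (-(n + 1 : ℝ)) (n + 1)) := by
    intro t ht
    rcases le_total ⌈|t|⌉₊ n with h | h
    · exact hmono h (hmem t)
    · exact (hmono h ht).symm
  refine ⟨fun t ↦ γ ⌈|t|⌉₊ t, hγ0 _, fun t ↦ ?_⟩
  exact (hγ _ t (hmem t)).congr_of_eventuallyEq
    ((heq ⌈|t|⌉₊).eventuallyEq_of_mem (Ioo_mem_nhds (hmem t).1 (hmem t).2))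

/-- The vector field of the `(p,q)`-twisted SL system. -/
noncomputable def twistedSLField (p q : ℕ) (z : ℂ × ℂ) : ℂ × ℂ :=
  ((starRingEnd ℂ z.1) ^ (p - 1) * (starRingEnd ℂ z.2) ^ q,
    -((starRingEnd ℂ z.1) ^ p * (starRingEnd ℂ z.2) ^ (q - 1)))

theorem contDiff_twistedSLField (p q : ℕ) : ContDiff ℝ 1 (twistedSLField p q) := by
  have h1 : ContDiff ℝ 1 fun z : ℂ × ℂ ↦ starRingEnd ℂ z.1 :=
    Complex.conjCLE.contDiff.comp contDiff_fst
  have h2 : ContDiff ℝ 1 fun z : ℂ × ℂ ↦ starRingEnd ℂ z.2 :=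
    Complex.conjCLE.contDiff.comp contDiff_snd
  exact ((h1.pow _).mul (h2.pow _)).prodMk ((h1.pow _).mul (h2.pow _)).neg

/-- The field of the twisted SL system is tangent to the spheres of `ℂ²`. -/
theorem inner_twistedSLField {p q : ℕ} (hp : 1 ≤ p) (hq : 1 ≤ q) (z : ℂ × ℂ) :
    inner ℝ z.1 (twistedSLField p q z).1 + inner ℝ z.2 (twistedSLField p q z).2 = 0 := by
  obtain ⟨a, rfl⟩ := Nat.exists_eq_add_of_le' hp
  obtain ⟨b, rfl⟩ := Nat.exists_eq_add_of_le' hq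
  simp only [Complex.inner, twistedSLField, Nat.add_sub_cancel, ← Complex.add_re]
  rw [← Complex.zero_re]
  congr 1
  ring

/-- `|w₁|² + |w₂|²` is conserved along every rescaling of the twisted SL field. -/
theorem norm_sq_add_norm_sq_eq_of_hasDerivAt {p q : ℕ} (hp : 1 ≤ p) (hq : 1 ≤ q)
    {c : ℝ → ℝ} {w : ℝ → ℂ × ℂ} (hw : ∀ t, HasDerivAt w (c t • twistedSLField p q (w t)) t)
    (t : ℝ) : ‖(w t).1‖ ^ 2 + ‖(w t).2‖ ^ 2 = ‖(w 0).1‖ ^ 2 + ‖(w 0).2‖ ^ 2 := by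
  have hderiv (t : ℝ) : HasDerivAt (fun s ↦ ‖(w s).1‖ ^ 2 + ‖(w s).2‖ ^ 2) 0 t := by
    have h1 : HasDerivAt (fun s ↦ (w s).1) (c t • twistedSLField p q (w t)).1 t := by
      simpa using (hw t).hasFDerivAt.fst.hasDerivAt
    have h2 : HasDerivAt (fun s ↦ (w s).2) (c t • twistedSLField p q (w t)).2 t := by
      simpa using (hw t).hasFDerivAt.snd.hasDerivAt
    refine (h1.norm_sq.add h2.norm_sq).congr_deriv ?_
    simp only [Prod.smul_fst, Prod.smul_snd, inner_smul_right]
    linear_combination (2 * c t) * inner_twistedSLField hp hq (w t)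
  exact is_const_of_deriv_eq_zero (fun t ↦ (hderiv t).differentiableAt)
    (fun t ↦ (hderiv t).deriv) t 0

theorem norm_le_norm_sq_add_norm_sq_add_one (z : ℂ × ℂ) :
    ‖z‖ ≤ ‖z.1‖ ^ 2 + ‖z.2‖ ^ 2 + 1 :=
  max_le (by nlinarith [sq_nonneg (‖z.1‖ - 1), sq_nonneg ‖z.2‖, sq_nonneg ‖z.1‖])
    (by nlinarith [sq_nonneg (‖z.2‖ - 1), sq_nonneg ‖z.1‖, sq_nonneg ‖z.2‖])

theorem existsUnique_twistedSLField_integralCurve {p q : ℕ} (hp : 1 ≤ p) (hq : 1 ≤ q)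
    (w₀ : ℂ × ℂ) :
    ∃! w : ℝ → ℂ × ℂ, w 0 = w₀ ∧ ∀ t, HasDerivAt w (twistedSLField p q (w t)) t := by
  let R : ℝ := ‖w₀.1‖ ^ 2 + ‖w₀.2‖ ^ 2 + 1
  have hR : 0 < R := by positivity
  let χ : ContDiffBump (0 : ℂ × ℂ) := ⟨R, R + 1, hR, lt_add_one R⟩
  let V : ℂ × ℂ → ℂ × ℂ := fun z ↦ χ z • twistedSLField p q z
  have hVsmooth : ContDiff ℝ 1 V := χ.contDiff.smul (contDiff_twistedSLField p q)
  have hVsupp : HasCompactSupport V := χ.hasCompactSupport.smul_right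
  obtain ⟨K, hK⟩ := hVsmooth.lipschitzWith_of_hasCompactSupport hVsupp one_ne_zero
  obtain ⟨L, hL⟩ := hVsupp.exists_bound_of_continuous hVsmooth.continuous
  have hcut {c : ℝ → ℝ} {w : ℝ → ℂ × ℂ} (hw0 : w 0 = w₀)
      (hw : ∀ t, HasDerivAt w (c t • twistedSLField p q (w t)) t) (t : ℝ) :
      V (w t) = twistedSLField p q (w t) := by
    have hmem : w t ∈ closedBall (0 : ℂ × ℂ) χ.rIn := by
      rw [mem_closedBall_zero_iff]
      refine (norm_le_norm_sq_add_norm_sq_add_one _).trans_eq ?_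
      rw [norm_sq_add_norm_sq_eq_of_hasDerivAt hp hq hw t, hw0]
    simp only [V, χ.one_of_mem_closedBall hmem, one_smul]
  have hsol {w : ℝ → ℂ × ℂ} (hw0 : w 0 = w₀)
      (hw : ∀ t, HasDerivAt w (twistedSLField p q (w t)) t) (t : ℝ) :
      HasDerivAt w (V (w t)) t := by
    rw [hcut (c := fun _ ↦ 1) hw0 (by simpa using hw) t]
    exact hw t
  obtain ⟨w, hw0, hw⟩ := exists_forall_hasDerivAt_of_lipschitzWith_of_bounded hK
    (L := L.toNNReal) (fun x ↦ (hL x).trans (Real.le_coe_toNNReal L)) w₀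
  have hw' (t : ℝ) : HasDerivAt w (twistedSLField p q (w t)) t :=
    hcut (c := fun t ↦ χ (w t)) hw0 hw t ▸ hw t
  refine ⟨w, ⟨hw0, hw'⟩, fun u ⟨hu0, hu⟩ ↦ ?_⟩
  exact ODE_solution_unique_univ (v := fun _ ↦ V) (s := fun _ ↦ univ) (t₀ := 0)
    (fun _ ↦ hK.lipschitzOnWith) (fun t ↦ ⟨hsol hu0 hu t, mem_univ _⟩)
    (fun t ↦ ⟨hw t, mem_univ _⟩) (hu0.trans hw0.symm)

/-- Global existence and uniqueness for the initial value problem of the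
`(p,q)`-twisted SL system. -/
theorem stmt_3 (p q : ℕ) (hp : 1 ≤ p) (hpq : p ≤ q) (hq : 2 ≤ q) (w₀ : ℂ × ℂ) :
    ∃! w : ℝ → ℂ × ℂ,
      w 0 = w₀ ∧
      ∀ t : ℝ,
        HasDerivAt (fun s => (w s).1)
          ((starRingEnd ℂ (w t).1) ^ (p - 1) * (starRingEnd ℂ (w t).2) ^ q) t ∧
        HasDerivAt (fun s => (w s).2)
          (-((starRingEnd ℂ (w t).1) ^ p * (starRingEnd ℂ (w t).2) ^ (q - 1))) t := by
  obtain ⟨w, ⟨hw0, hw⟩, huniq⟩ :=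
    existsUnique_twistedSLField_integralCurve hp (hp.trans hpq) w₀
  exact ⟨w, ⟨hw0, fun t ↦ ⟨(hw t).fst, (hw t).snd⟩⟩,
    fun u ⟨hu0, hu⟩ ↦ huniq u ⟨hu0, fun t ↦ (hu t).1.prodMk (hu t).2⟩⟩
end

section
/- For 0 < τ < τ_max let y_min(τ) ∈ (0, q/n) and y_max(τ) ∈ (q/n, 1) denote the two roots of y^q·(1−y)^p = 4τ² in [0,1]. Then there exist constants C > 0 and δ > 0 such that for all τ with 0 < τ < δ: |y_min(τ)·(2τ)^(−2/q) − 1| ≤ C·τ^(2/q) and |(1 − y_max(τ))·(2τ)^(−2/p) − 1| ≤ C·τ^(2/p). In particular y_min(τ)/(2τ)^(2/q) → 1 and (1 − y_max(τ))/(2τ)^(2/p) → 1 as τ → 0⁺, i.e. y_min(τ) = (2τ)^(2/q)·(1 + O(τ^(2/q))) and y_max(τ) = 1 − (2τ)^(2/p)·(1 + O(τ^(2/p))). -/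
/-- If `x ^ a * (1 - x) ^ b = 4 * τ ^ 2` and `x ≤ c < 1`, then `x` agrees with `(2 * τ) ^ (2 / a)` up to
a relative error of order `τ ^ (2 / a)`, with an explicit constant. -/
theorem abs_mul_rpow_sub_one_le {a b : ℕ} (ha : a ≠ 0) {x c τ : ℝ} (hτ : 0 < τ) (hx : 0 < x)
    (hxc : x ≤ c) (hc : c < 1) (h : x ^ a * (1 - x) ^ b = 4 * τ ^ 2) :
    |x * (2 * τ) ^ (-(2 : ℝ) / (a : ℝ)) - 1| ≤
      b / (1 - c) ^ (2 * b) * 2 ^ ((2 : ℝ) / (a : ℝ)) * τ ^ ((2 : ℝ) / (a : ℝ)) := by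
  have ha' : (a : ℝ) ≠ 0 := Nat.cast_ne_zero.mpr ha
  have hτ2 : 0 < 2 * τ := by positivity
  have hx1 : 0 < 1 - x := by linarith
  have hc1 : 0 < 1 - c := by linarith
  rw [mul_assoc, ← Real.mul_rpow zero_le_two hτ.le, neg_div, Real.rpow_neg hτ2.le]
  set t : ℝ := (2 * τ) ^ ((2 : ℝ) / (a : ℝ)) with ht
  have ht0 : 0 < t := Real.rpow_pos_of_pos hτ2 _
  have hta : t ^ a = 4 * τ ^ 2 := by
    rw [ht, ← Real.rpow_natCast, ← Real.rpow_mul hτ2.le, div_mul_cancel₀ _ ha', Real.rpow_two]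
    ring
  set w : ℝ := x * t⁻¹ with hw
  have hw0 : 0 < w := by positivity
  have hxw : x = w * t := by rw [hw]; field_simp
  have hP0 : 0 < (1 - x) ^ b := by positivity
  have hwa : w ^ a = 1 / (1 - x) ^ b := by
    rw [hw, mul_pow, inv_pow, hta, ← h]
    field_simp
  have hP1 : (1 - x) ^ b ≤ 1 := pow_le_one₀ hx1.le (by linarith)
  have hwa1 : 1 ≤ w ^ a := by
    rw [hwa]
    exact one_le_one_div hP0 hP1
  have hw1 : 1 ≤ w := by
    by_contra! hlt
    exact absurd hwa1 (not_le.mpr (pow_lt_one₀ hw0.le hlt ha))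
  have hwP : w ≤ 1 / (1 - x) ^ b := hwa ▸ le_self_pow₀ hw1 ha
  have hQ0 : 0 < (1 - c) ^ b := by positivity
  have hPQ : (1 - c) ^ b ≤ (1 - x) ^ b := by gcongr
  have hbern : 1 - b * x ≤ (1 - x) ^ b := by
    have := one_add_mul_le_pow (a := -x) (by linarith) b
    rw [← sub_eq_add_neg] at this
    linarith
  have hxt : x ≤ t / (1 - c) ^ b := by
    calc x = w * t := hxw
      _ ≤ 1 / (1 - c) ^ b * t := by
        gcongr
        exact hwP.trans (one_div_le_one_div_of_le hQ0 hPQ)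
      _ = t / (1 - c) ^ b := by ring
  rw [abs_of_nonneg (by linarith)]
  calc w - 1 ≤ 1 / (1 - x) ^ b - 1 := by linarith
    _ = (1 - (1 - x) ^ b) / (1 - x) ^ b := by field_simp
    _ ≤ b * x / (1 - x) ^ b := by gcongr; linarith
    _ ≤ b * (t / (1 - c) ^ b) / (1 - c) ^ b := by gcongr
    _ = b / (1 - c) ^ (2 * b) * t := by rw [two_mul, pow_add]; field_simp

/-- If `y τ * (2 * τ) ^ (-2 / a)` is within `C * τ ^ (2 / a)` of `1` for small `τ > 0`, then
`y τ` is asymptotic to `(2 * τ) ^ (2 / a)`. -/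
theorem tendsto_div_rpow_of_abs_sub_one_le {a : ℕ} (ha : a ≠ 0) {y : ℝ → ℝ} {C δ : ℝ} (hδ : 0 < δ)
    (h : ∀ τ : ℝ, 0 < τ → τ < δ →
      |y τ * (2 * τ) ^ (-(2 : ℝ) / (a : ℝ)) - 1| ≤ C * τ ^ ((2 : ℝ) / (a : ℝ))) :
    Filter.Tendsto (fun τ : ℝ => y τ / (2 * τ) ^ ((2 : ℝ) / (a : ℝ)))
      (nhdsWithin 0 (Set.Ioi 0)) (nhds 1) := by
  have he : 0 < (2 : ℝ) / (a : ℝ) := by positivity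
  have hlim : Filter.Tendsto (fun τ : ℝ => C * τ ^ ((2 : ℝ) / (a : ℝ)))
      (nhdsWithin 0 (Set.Ioi 0)) (nhds 0) := by
    have hcont := ((Real.continuousAt_rpow_const 0 _ (Or.inr he.le)).const_mul C).tendsto
    rw [Real.zero_rpow he.ne', mul_zero] at hcont
    exact hcont.mono_left nhdsWithin_le_nhds
  rw [tendsto_iff_dist_tendsto_zero]
  refine squeeze_zero' (Filter.Eventually.of_forall fun _ => dist_nonneg) ?_ hlim
  filter_upwards [Ioo_mem_nhdsGT hδ] with τ hτ
  have hτ2 : 0 ≤ 2 * τ := by linarith [hτ.1]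
  have := h τ hτ.1 hτ.2
  rwa [neg_div, Real.rpow_neg hτ2, ← div_eq_mul_inv] at this


/-- Small-`τ` asymptotics of the roots `y_min(τ)` and `y_max(τ)` of `y^q (1-y)^p = 4τ²`:
`y_min = (2τ)^{2/q}(1 + O(τ^{2/q}))` and `y_max = 1 - (2τ)^{2/p}(1 + O(τ^{2/p}))`. -/
theorem stmt_6 (p q : ℕ) (hp : 1 ≤ p) (hpq : p ≤ q) (hq : 2 ≤ q)
    (ymin ymax : ℝ → ℝ)
    (hmin : ∀ τ : ℝ, 0 < τ →
      τ < Real.sqrt ((p : ℝ) ^ p * (q : ℝ) ^ q / ((p : ℝ) + q) ^ (p + q)) / 2 →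
      ymin τ ∈ Set.Ioo (0 : ℝ) ((q : ℝ) / ((p : ℝ) + q)) ∧
        (ymin τ) ^ q * (1 - ymin τ) ^ p = 4 * τ ^ 2)
    (hmax : ∀ τ : ℝ, 0 < τ →
      τ < Real.sqrt ((p : ℝ) ^ p * (q : ℝ) ^ q / ((p : ℝ) + q) ^ (p + q)) / 2 →
      ymax τ ∈ Set.Ioo ((q : ℝ) / ((p : ℝ) + q)) 1 ∧
        (ymax τ) ^ q * (1 - ymax τ) ^ p = 4 * τ ^ 2) :
    (∃ C > (0 : ℝ), ∃ δ > (0 : ℝ), ∀ τ : ℝ, 0 < τ → τ < δ →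
      τ < Real.sqrt ((p : ℝ) ^ p * (q : ℝ) ^ q / ((p : ℝ) + q) ^ (p + q)) / 2 →
      |ymin τ * (2 * τ) ^ (-(2 : ℝ) / (q : ℝ)) - 1| ≤ C * τ ^ ((2 : ℝ) / (q : ℝ)) ∧
      |(1 - ymax τ) * (2 * τ) ^ (-(2 : ℝ) / (p : ℝ)) - 1| ≤ C * τ ^ ((2 : ℝ) / (p : ℝ))) ∧
    Filter.Tendsto (fun τ : ℝ => ymin τ / (2 * τ) ^ ((2 : ℝ) / (q : ℝ)))
      (nhdsWithin 0 (Set.Ioi 0)) (nhds 1) ∧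
    Filter.Tendsto (fun τ : ℝ => (1 - ymax τ) / (2 * τ) ^ ((2 : ℝ) / (p : ℝ)))
      (nhdsWithin 0 (Set.Ioi 0)) (nhds 1) := by
  have hp0 : p ≠ 0 := by omega
  have hq0 : q ≠ 0 := by omega
  have hpR : 0 < (p : ℝ) := by positivity
  have hqR : 0 < (q : ℝ) := by positivity
  set T : ℝ := Real.sqrt ((p : ℝ) ^ p * (q : ℝ) ^ q / ((p : ℝ) + q) ^ (p + q)) / 2
  have hT0 : 0 < T := by positivity
  have hsum : (p : ℝ) / (p + q) = 1 - q / (p + q) := by field_simp; ring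
  have hcq : (q : ℝ) / (p + q) < 1 := by rw [div_lt_one (by positivity)]; linarith
  have hcp : (p : ℝ) / (p + q) < 1 := by rw [div_lt_one (by positivity)]; linarith
  set A : ℝ := p / (1 - q / (p + q)) ^ (2 * p) * 2 ^ ((2 : ℝ) / (q : ℝ))
  set B : ℝ := q / (1 - p / (p + q)) ^ (2 * q) * 2 ^ ((2 : ℝ) / (p : ℝ))
  have hymin : ∀ τ : ℝ, 0 < τ → τ < T →
      |ymin τ * (2 * τ) ^ (-(2 : ℝ) / (q : ℝ)) - 1| ≤ A * τ ^ ((2 : ℝ) / (q : ℝ)) := by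
    intro τ hτ hτT
    obtain ⟨⟨h0, h1⟩, h⟩ := hmin τ hτ hτT
    exact abs_mul_rpow_sub_one_le hq0 hτ h0 h1.le hcq h
  have hymax : ∀ τ : ℝ, 0 < τ → τ < T →
      |(1 - ymax τ) * (2 * τ) ^ (-(2 : ℝ) / (p : ℝ)) - 1| ≤ B * τ ^ ((2 : ℝ) / (p : ℝ)) := by
    intro τ hτ hτT
    obtain ⟨⟨h0, h1⟩, h⟩ := hmax τ hτ hτT
    refine abs_mul_rpow_sub_one_le hp0 hτ (by linarith) (by linarith) hcp ?_
    rw [sub_sub_cancel, mul_comm, h]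
  have hA0 : 0 < A := mul_pos (div_pos hpR (pow_pos (by linarith) _)) (by positivity)
  refine ⟨⟨max A B, lt_max_of_lt_left hA0, T, hT0, fun τ hτ hτT _ => ⟨?_, ?_⟩⟩,
    tendsto_div_rpow_of_abs_sub_one_le hq0 hT0 hymin,
    tendsto_div_rpow_of_abs_sub_one_le hp0 hT0 hymax⟩
  · exact (hymin τ hτ hτT).trans (by gcongr; exact le_max_left A B)
  · exact (hymax τ hτ hτT).trans (by gcongr; exact le_max_right A B)
end

section
/- Let τ ∈ ℝ satisfy 0 < |τ| < τ_max, and let y : ℝ → ℝ be twice differentiable with y(0) ∈ [0,1], y″(t) = 2·y(t)^(q−1)·(1 − y(t))^(p−1)·(q − n·y(t)) for all t ∈ ℝ, and y′(t)² = 4·(y(t)^q·(1 − y(t))^p − 4τ²) for all t ∈ ℝ. Then y is nonconstant and periodic: there exists a least P > 0 such that y(t + P) = y(t) for all t. Moreover, any two functions with these properties differ by a time translation: if ỹ also satisfies all the hypotheses then there exists t₀ ∈ ℝ with ỹ(t) = y(t + t₀) for all t. -/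
open Set Filter Topology

/-- A continuous nonconstant periodic function on `ℝ` has a least positive period. -/
theorem Function.Periodic.exists_least_pos {α : Type*} [TopologicalSpace α] [T2Space α]
    {f : ℝ → α} (hf : Continuous f) (hne : ∃ s t, f s ≠ f t) {c : ℝ} (hc : c ≠ 0)
    (hper : Function.Periodic f c) :
    ∃ P, 0 < P ∧ Function.Periodic f P ∧ ∀ P', 0 < P' → Function.Periodic f P' → P ≤ P' := by
  let H : AddSubgroup ℝ :=
    { carrier := {a | Function.Periodic f a}
      zero_mem' := fun x => by simp
      add_mem' := fun ha hb => ha.add_period hb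
      neg_mem' := fun ha => ha.neg }
  have mem_H : ∀ a, a ∈ H ↔ Function.Periodic f a := fun a => Iff.rfl
  rcases H.dense_or_cyclic with hd | ⟨a, ha⟩
  · exfalso
    have hconst : f = fun _ => f 0 :=
      hf.ext_on hd continuous_const fun a ha => by simpa using (mem_H a).1 ha 0
    obtain ⟨s, t, hst⟩ := hne
    exact hst ((congrFun hconst s).trans (congrFun hconst t).symm)
  · have mem_iff : ∀ b, Function.Periodic f b ↔ ∃ n : ℤ, n • a = b := fun b => by
      rw [← mem_H, ha, AddSubgroup.mem_closure_singleton]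
    have ha0 : a ≠ 0 := by
      rintro rfl
      obtain ⟨n, hn⟩ := (mem_iff c).1 hper
      exact hc (by simpa using hn.symm)
    have haper : Function.Periodic f a := (mem_iff a).2 ⟨1, one_zsmul a⟩
    refine ⟨|a|, abs_pos.2 ha0, ?_, fun P' hP' hper' => ?_⟩
    · rcases abs_choice a with h | h <;> rw [h]
      exacts [haper, haper.neg]
    · obtain ⟨n, rfl⟩ := (mem_iff P').1 hper'
      have hn : n ≠ 0 := by
        rintro rfl
        simp at hP'
      have h1 : (1 : ℝ) ≤ |(n : ℝ)| := by exact_mod_cast Int.one_le_abs hn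
      calc |a| ≤ |(n : ℝ)| * |a| := le_mul_of_one_le_left (abs_nonneg a) h1
        _ = n • a := by rw [← abs_mul, ← zsmul_eq_mul, abs_of_pos hP']

/-- A function whose derivative is at least `d > 0` on `[T, ∞)` is not bounded above there. -/
theorem false_of_bdd_of_le_hasDerivAt {u u' : ℝ → ℝ} (hu : ∀ t, HasDerivAt u (u' t) t)
    {T d M : ℝ} (hd : 0 < d) (hM : ∀ t, T ≤ t → u t ≤ M) (h : ∀ t, T ≤ t → d ≤ u' t) : False := by
  have key := (convex_Ici T).mul_sub_le_image_sub_of_le_deriv (f := u) (C := d)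
    (fun t _ => (hu t).continuousAt.continuousWithinAt)
    (fun t _ => (hu t).differentiableAt.differentiableWithinAt)
    (fun t ht => by
      rw [(hu t).deriv]
      exact h t (interior_subset ht))
  have hs : 0 ≤ (M - u T) / d := div_nonneg (sub_nonneg.2 (hM T le_rfl)) hd.le
  have h1 := key T self_mem_Ici (T + ((M - u T) / d + 1)) (by simp only [mem_Ici]; linarith)
    (by linarith)
  have h2 := hM (T + ((M - u T) / d + 1)) (by linarith)
  have h3 : d * ((M - u T) / d) = M - u T := mul_div_cancel₀ _ hd.ne'
  nlinarith

/-- A bounded solution of `u'' = -G u` with `G ≥ k > 0` cannot stay negative. -/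
theorem not_eventually_neg_of_oscillator {u u' u'' G : ℝ → ℝ}
    (hu : ∀ t, HasDerivAt u (u' t) t) (hu' : ∀ t, HasDerivAt u' (u'' t) t)
    {k M : ℝ} (hk : 0 < k) (hG : ∀ t, k ≤ G t) (hode : ∀ t, u'' t = -G t * u t)
    (hM : ∀ t, |u t| ≤ M) (T : ℝ) : ¬ ∀ t, T ≤ t → u t < 0 := by
  intro hneg
  have hmono : MonotoneOn u' (Ici T) := monotoneOn_of_deriv_nonneg (convex_Ici T)
    (fun t _ => (hu' t).continuousAt.continuousWithinAt)
    (fun t _ => (hu' t).differentiableAt.differentiableWithinAt)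
    (fun t ht => by
      rw [(hu' t).deriv, hode]
      nlinarith [hG t, hneg t (interior_subset ht)])
  by_cases hpos : ∃ s, T ≤ s ∧ 0 < u' s
  · obtain ⟨s, hs, hus⟩ := hpos
    exact false_of_bdd_of_le_hasDerivAt hu hus (fun t _ => (abs_le.1 (hM t)).2)
      (fun t ht => hmono hs (hs.trans ht) ht)
  · push Not at hpos
    have hanti : AntitoneOn u (Ici T) := antitoneOn_of_deriv_nonpos (convex_Ici T)
      (fun t _ => (hu t).continuousAt.continuousWithinAt)
      (fun t _ => (hu t).differentiableAt.differentiableWithinAt)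
      (fun t ht => by
        rw [(hu t).deriv]
        exact hpos t (interior_subset ht))
    refine false_of_bdd_of_le_hasDerivAt hu' (mul_pos hk (neg_pos.2 (hneg T le_rfl))) hpos
      (fun t ht => ?_)
    rw [hode]
    nlinarith [hG t, hneg t ht, hanti self_mem_Ici ht ht]

/-- A bounded solution of `u'' = -G u` with `G ≥ k > 0` all of whose zeros are simple has
arbitrarily late zeros at which it is increasing. -/
theorem exists_upcrossing_of_oscillator {u u' u'' G : ℝ → ℝ}
    (hu : ∀ t, HasDerivAt u (u' t) t) (hu' : ∀ t, HasDerivAt u' (u'' t) t)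
    {k M : ℝ} (hk : 0 < k) (hG : ∀ t, k ≤ G t) (hode : ∀ t, u'' t = -G t * u t)
    (hM : ∀ t, |u t| ≤ M) (hsimple : ∀ t, u t = 0 → u' t ≠ 0) (T : ℝ) :
    ∃ s, T ≤ s ∧ u s = 0 ∧ 0 < u' s := by
  obtain ⟨a, hTa, ha⟩ : ∃ a, T ≤ a ∧ u a < 0 := by
    by_contra! hnonneg
    refine not_eventually_neg_of_oscillator (u := fun t => -u t) (fun t => (hu t).neg)
      (fun t => (hu' t).neg) hk hG (fun t => by rw [hode]; ring)
      (fun t => by rw [abs_neg]; exact hM t) (T + 1) fun t ht => ?_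
    have hTt : T < t := by linarith
    refine neg_neg_of_pos ((hnonneg t hTt.le).lt_of_ne' fun h0 => hsimple t h0 ?_)
    have hmin : IsLocalMin u t := by
      filter_upwards [Ioi_mem_nhds hTt] with x hx
      rw [h0]
      exact hnonneg x (le_of_lt hx)
    exact hmin.hasDerivAt_eq_zero (hu t)
  have hcont : Continuous u := continuous_iff_continuousAt.2 fun t => (hu t).continuousAt
  obtain ⟨b, hab, hb⟩ : ∃ b, a ≤ b ∧ 0 ≤ u b := by
    by_contra! hneg
    exact not_eventually_neg_of_oscillator hu hu' hk hG hode hM a hneg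
  have hcpt : IsCompact (Icc a b ∩ u ⁻¹' {0}) :=
    isCompact_Icc.inter_right (isClosed_singleton.preimage hcont)
  have hnonempty : (Icc a b ∩ u ⁻¹' {0}).Nonempty := by
    obtain ⟨x, hx, hx0⟩ := intermediate_value_Icc hab hcont.continuousOn ⟨ha.le, hb⟩
    exact ⟨x, hx, hx0⟩
  obtain ⟨s, ⟨⟨has, hsb⟩, hs0⟩, hleast⟩ := hcpt.exists_isLeast hnonempty
  have hs0 : u s = 0 := hs0
  have has' : a < s := has.lt_of_ne fun h => by rw [h, hs0] at ha; exact lt_irrefl _ ha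
  have hneg : ∀ t ∈ Ioo a s, u t ≤ 0 := fun t ht => by
    by_contra! hpos
    obtain ⟨x, hx, hx0⟩ := intermediate_value_Icc ht.1.le hcont.continuousOn ⟨ha.le, hpos.le⟩
    have := hleast ⟨⟨hx.1, (hx.2.trans ht.2.le).trans hsb⟩, hx0⟩
    exact absurd (hx.2.trans_lt ht.2) this.not_gt
  refine ⟨s, hTa.trans has, hs0, lt_of_le_of_ne' ?_ (hsimple s hs0)⟩
  refine ge_of_tendsto ((hasDerivWithinAt_iff_tendsto_slope' self_notMem_Iio).1
    (hu s).hasDerivWithinAt) ?_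
  filter_upwards [Ioo_mem_nhdsLT has'] with t ht
  rw [slope_def_field, hs0]
  exact div_nonneg_of_nonpos (by linarith [hneg t ht]) (by linarith [ht.2])

/-- Solutions of a second-order equation `y'' = F y` staying in an interval on which `F` is
Lipschitz are determined by their position and velocity at one time. -/
theorem eq_of_secondOrder_ode {F : ℝ → ℝ} {I : Set ℝ} {K : NNReal} (hF : LipschitzOnWith K F I)
    {y y' z z' : ℝ → ℝ}
    (hy : ∀ t, HasDerivAt y (y' t) t) (hy' : ∀ t, HasDerivAt y' (F (y t)) t)
    (hyI : ∀ t, y t ∈ I)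
    (hz : ∀ t, HasDerivAt z (z' t) t) (hz' : ∀ t, HasDerivAt z' (F (z t)) t)
    (hzI : ∀ t, z t ∈ I) {t₀ : ℝ} (h : y t₀ = z t₀) (h' : y' t₀ = z' t₀) : y = z := by
  have hlip : LipschitzOnWith (max 1 (K * 1)) (fun x : ℝ × ℝ => (x.2, F x.1)) (Prod.fst ⁻¹' I) :=
    LipschitzWith.prod_snd.lipschitzOnWith.prodMk
      (hF.comp LipschitzWith.prod_fst.lipschitzOnWith fun _ hx => hx)
  have key : (fun t => (y t, y' t)) = fun t => (z t, z' t) :=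
    ODE_solution_unique_univ (v := fun _ x => (x.2, F x.1)) (s := fun _ => Prod.fst ⁻¹' I)
      (t₀ := t₀) (fun _ => hlip)
      (fun t => ⟨(hy t).prodMk (hy' t), hyI t⟩) (fun t => ⟨(hz t).prodMk (hz' t), hzI t⟩)
      (by simp only [h, h'])
  exact funext fun t => congrArg Prod.fst (congrFun key t)

/-- A solution on a positive energy level stays in `(0, 1)`. -/
theorem mem_Ioo_of_energy {p q : ℕ} (hp : p ≠ 0) (hq : q ≠ 0) {τ : ℝ} (hτ : τ ≠ 0)
    {y y' : ℝ → ℝ} (hy : Continuous y) (h0 : y 0 ∈ Icc (0 : ℝ) 1)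
    (hen : ∀ t, (y' t) ^ 2 = 4 * ((y t) ^ q * (1 - y t) ^ p - 4 * τ ^ 2)) (t : ℝ) :
    y t ∈ Ioo (0 : ℝ) 1 := by
  have hτ2 : 0 < τ ^ 2 := by positivity
  have hne0 : ∀ s, y s ≠ 0 := fun s hs => by
    have := hen s
    rw [hs, zero_pow hq] at this
    nlinarith [sq_nonneg (y' s)]
  have hne1 : ∀ s, y s ≠ 1 := fun s hs => by
    have := hen s
    rw [hs, sub_self, zero_pow hp] at this
    nlinarith [sq_nonneg (y' s)]
  constructor
  · by_contra! h
    obtain ⟨s, hs⟩ := mem_range_of_exists_le_of_exists_ge hy ⟨t, h⟩ ⟨0, h0.1⟩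
    exact hne0 s hs
  · by_contra! h
    obtain ⟨s, hs⟩ := mem_range_of_exists_le_of_exists_ge hy ⟨0, h0.2⟩ ⟨t, h⟩
    exact hne1 s hs

/-- A solution on a subcritical energy level has arbitrarily late times at which it passes
through the critical point `q / (p + q)` with the positive velocity prescribed by the energy. -/
theorem exists_upcrossing_of_energy {p q : ℕ} (hp : p ≠ 0) (hq : q ≠ 0) {τ : ℝ} (hτ0 : τ ≠ 0)
    {c : ℝ} (hc : c = (q : ℝ) / ((p : ℝ) + q)) (hτ : 4 * τ ^ 2 < c ^ q * (1 - c) ^ p)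
    {y y' y'' : ℝ → ℝ}
    (hy : ∀ t, HasDerivAt y (y' t) t) (hy' : ∀ t, HasDerivAt y' (y'' t) t)
    (h0 : y 0 ∈ Icc (0 : ℝ) 1)
    (hode : ∀ t, y'' t =
      2 * (y t) ^ (q - 1) * (1 - y t) ^ (p - 1) * ((q : ℝ) - ((p : ℝ) + q) * y t))
    (hen : ∀ t, (y' t) ^ 2 = 4 * ((y t) ^ q * (1 - y t) ^ p - 4 * τ ^ 2)) (T : ℝ) :
    ∃ s, T ≤ s ∧ y s = c ∧ 0 < y' s ∧
      y' s = Real.sqrt (4 * (c ^ q * (1 - c) ^ p - 4 * τ ^ 2)) := by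
  have hmem := mem_Ioo_of_energy hp hq hτ0
    (continuous_iff_continuousAt.2 fun t => (hy t).continuousAt) h0 hen
  have hn : 0 < (p : ℝ) + q := by positivity
  have hqc : (q : ℝ) = ((p : ℝ) + q) * c := by rw [hc]; field_simp
  have hτ2 : 0 < τ ^ 2 := by positivity
  have hlow : ∀ t, 4 * τ ^ 2 ≤ y t ^ (q - 1) * (1 - y t) ^ (p - 1) := fun t => by
    obtain ⟨hyt0, hyt1⟩ := hmem t
    have hf : 4 * τ ^ 2 ≤ y t ^ q * (1 - y t) ^ p := by nlinarith [hen t, sq_nonneg (y' t)]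
    have hle : y t * (1 - y t) ≤ 1 := by nlinarith
    have hpos : 0 ≤ y t ^ (q - 1) * (1 - y t) ^ (p - 1) :=
      mul_nonneg (pow_nonneg hyt0.le _) (pow_nonneg (sub_nonneg.2 hyt1.le) _)
    calc 4 * τ ^ 2 ≤ y t ^ q * (1 - y t) ^ p := hf
      _ = y t ^ (q - 1) * (1 - y t) ^ (p - 1) * (y t * (1 - y t)) := by
        rw [← pow_sub_one_mul hq, ← pow_sub_one_mul hp]
        ring
      _ ≤ y t ^ (q - 1) * (1 - y t) ^ (p - 1) := mul_le_of_le_one_right hpos hle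
  have hc01 : 0 ≤ c ∧ c ≤ 1 := by
    rw [hc]
    exact ⟨by positivity, div_le_one_of_le₀ (by linarith [p.cast_nonneg (α := ℝ)]) hn.le⟩
  obtain ⟨s, hTs, hs, hs'⟩ := exists_upcrossing_of_oscillator (u := fun t => y t - c)
    (G := fun t => 2 * ((p : ℝ) + q) * (y t ^ (q - 1) * (1 - y t) ^ (p - 1)))
    (k := 2 * ((p : ℝ) + q) * (4 * τ ^ 2)) (M := 1)
    (fun t => (hy t).sub_const c) hy' (by positivity)
    (fun t => mul_le_mul_of_nonneg_left (hlow t) (by positivity))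
    (fun t => by
      rw [hode]
      linear_combination 2 * (y t) ^ (q - 1) * (1 - y t) ^ (p - 1) * hqc)
    (fun t => abs_le.2 ⟨by linarith [(hmem t).1], by linarith [(hmem t).2]⟩)
    (fun t ht h' => by
      have := hen t
      rw [h', sub_eq_zero.1 ht] at this
      linarith) T
  have hsc : y s = c := sub_eq_zero.1 hs
  refine ⟨s, hTs, hsc, hs', ?_⟩
  rw [← hsc, ← hen s, Real.sqrt_sq hs'.le]


/-- For `0 < |τ| < τ_max`, any solution of `y'' = 2 f'(y)` lying on the energy level
`y'² = 4(f(y) - 4τ²)` with `y(0) ∈ [0,1]` is nonconstant and periodic with a least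
positive period, and any two such solutions differ by a time translation. -/
theorem stmt_7 (p q : ℕ) (hp : 1 ≤ p) (hpq : p ≤ q) (hq : 2 ≤ q) (τ : ℝ)
    (hτ0 : 0 < |τ|)
    (hτ : |τ| < Real.sqrt ((p : ℝ) ^ p * (q : ℝ) ^ q / ((p : ℝ) + q) ^ (p + q)) / 2)
    (y y' y'' : ℝ → ℝ)
    (hy : ∀ t, HasDerivAt y (y' t) t)
    (hy' : ∀ t, HasDerivAt y' (y'' t) t)
    (h0 : y 0 ∈ Set.Icc (0 : ℝ) 1)
    (hode : ∀ t, y'' t =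
      2 * (y t) ^ (q - 1) * (1 - y t) ^ (p - 1) * ((q : ℝ) - ((p : ℝ) + q) * y t))
    (hen : ∀ t, (y' t) ^ 2 = 4 * ((y t) ^ q * (1 - y t) ^ p - 4 * τ ^ 2)) :
    ((∃ s t, y s ≠ y t) ∧
      ∃ P, 0 < P ∧ (∀ t, y (t + P) = y t) ∧
        ∀ P', 0 < P' → (∀ t, y (t + P') = y t) → P ≤ P') ∧
    ∀ z z' z'' : ℝ → ℝ,
      (∀ t, HasDerivAt z (z' t) t) →
      (∀ t, HasDerivAt z' (z'' t) t) →
      z 0 ∈ Set.Icc (0 : ℝ) 1 →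
      (∀ t, z'' t =
        2 * (z t) ^ (q - 1) * (1 - z t) ^ (p - 1) * ((q : ℝ) - ((p : ℝ) + q) * z t)) →
      (∀ t, (z' t) ^ 2 = 4 * ((z t) ^ q * (1 - z t) ^ p - 4 * τ ^ 2)) →
      ∃ t₀, ∀ t, z t = y (t + t₀) := by
  
  have hp0 : p ≠ 0 := by omega
  have hq0 : q ≠ 0 := by omega
  have hτne : τ ≠ 0 := abs_pos.1 hτ0
  have hn : (p : ℝ) + q ≠ 0 := by positivity
  obtain ⟨c, hc⟩ : ∃ c, c = (q : ℝ) / ((p : ℝ) + q) := ⟨_, rfl⟩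
  have hfc : 4 * τ ^ 2 < c ^ q * (1 - c) ^ p := by
    have h1c : 1 - c = (p : ℝ) / ((p : ℝ) + q) := by rw [hc]; field_simp; ring
    have hval : c ^ q * (1 - c) ^ p =
        (p : ℝ) ^ p * (q : ℝ) ^ q / ((p : ℝ) + q) ^ (p + q) := by
      rw [h1c, hc, div_pow, div_pow, pow_add]
      field_simp
    rw [hval]
    have h2 := (Real.lt_sqrt (by positivity)).1 (show 2 * |τ| < _ by linarith)
    rw [mul_pow, sq_abs] at h2
    linarith
  let F : ℝ → ℝ := fun x =>
    2 * x ^ (q - 1) * (1 - x) ^ (p - 1) * ((q : ℝ) - ((p : ℝ) + q) * x)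
  have hF : ContDiff ℝ 1 F := by fun_prop
  obtain ⟨K, hK⟩ := hF.contDiffOn.exists_lipschitzOnWith one_ne_zero (convex_Icc (0 : ℝ) 1)
    isCompact_Icc
  have hyF : ∀ t, HasDerivAt y' (F (y t)) t := fun t => (hy' t).congr_deriv (hode t)
  have hyI : ∀ t, y t ∈ Icc (0 : ℝ) 1 := fun t => Ioo_subset_Icc_self <|
    mem_Ioo_of_energy hp0 hq0 hτne
      (continuous_iff_continuousAt.2 fun t => (hy t).continuousAt) h0 hen t
  have hup := exists_upcrossing_of_energy hp0 hq0 hτne hc hfc hy hy' h0 hode hen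
  have translate : ∀ (z z' : ℝ → ℝ) (s r : ℝ), (∀ t, HasDerivAt z (z' t) t) →
      (∀ t, HasDerivAt z' (F (z t)) t) → (∀ t, z t ∈ Icc (0 : ℝ) 1) →
      z s = y r → z' s = y' r → ∀ t, z t = y (t + (r - s)) := by
    intro z z' s r hz hz' hzI h h'
    have hsr : s + (r - s) = r := by ring
    exact congrFun (eq_of_secondOrder_ode hK hz hz' hzI
      (z := fun t => y (t + (r - s))) (z' := fun t => y' (t + (r - s)))
      (fun t => (hy _).comp_add_const t (r - s)) (fun t => (hyF _).comp_add_const t (r - s))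
      (fun t => hyI _) (t₀ := s) (by simp only [hsr, h]) (by simp only [hsr, h']))
  obtain ⟨s, -, hs, hspos, hs'⟩ := hup 0
  have hne : ∃ a b, y a ≠ y b := by
    by_contra! hconst
    have hy0 : y = fun _ => y 0 := funext fun t => hconst t 0
    have hd := hy s
    rw [hy0] at hd
    exact hspos.ne' (hd.unique (hasDerivAt_const s (y 0)))
  refine ⟨⟨hne, ?_⟩, ?_⟩
  · obtain ⟨r, hsr, hr, -, hr'⟩ := hup (s + 1)
    have hper : Function.Periodic y (r - s) := fun t =>
      (translate y y' s r hy hyF hyI (hs.trans hr.symm) (hs'.trans hr'.symm) t).symm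
    exact hper.exists_least_pos (continuous_iff_continuousAt.2 fun t => (hy t).continuousAt)
      hne (by linarith)
  · intro z z' z'' hz hz' hz0 hzode hzen
    obtain ⟨r, -, hr, -, hr'⟩ :=
      exists_upcrossing_of_energy hp0 hq0 hτne hc hfc hz hz' hz0 hzode hzen 0
    exact ⟨s - r, translate z z' r s hz (fun t => (hz' t).congr_deriv (hzode t))
      (fun t => Ioo_subset_Icc_self <| mem_Ioo_of_energy hp0 hq0 hτne
        (continuous_iff_continuousAt.2 fun t => (hz t).continuousAt) hz0 hzen t)
      (hr.trans hs.symm) (hr'.trans hs'.symm)⟩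
end

section
/- Let p and q be integers with p ≥ 2 and q ≥ 2. Suppose y : ℝ → [0,1] is differentiable, satisfies y′(t)² = 4·y(t)^q·(1 − y(t))^p for all t ∈ ℝ, and is not constant. Then 0 < y(t) < 1 for all t, y is strictly monotone, and either y is strictly decreasing with y(t) → 1 as t → −∞ and y(t) → 0 as t → +∞, or y is strictly increasing with y(t) → 0 as t → −∞ and y(t) → 1 as t → +∞. -/
open Filter

lemma eq_zero_of_hasDerivAt_of_abs_le_mul_abs {u u' : ℝ → ℝ} {K s : ℝ}
    (hu : ∀ t, HasDerivAt u (u' t) t) (hK : ∀ t, |u' t| ≤ K * |u t|) (hs : u s = 0) (t : ℝ) :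
    u t = 0 := by
  have forward : ∀ {v v' : ℝ → ℝ} {a b : ℝ}, (∀ t, HasDerivAt v (v' t) t) →
      (∀ t, |v' t| ≤ K * |v t|) → v a = 0 → a ≤ b → v b = 0 := by
    intro v v' a b hv hvK ha hab
    exact eq_zero_of_abs_deriv_le_mul_abs_self_of_eq_zero_right
      (fun x _ => (hv x).continuousAt.continuousWithinAt)
      (fun x _ => (hv x).hasDerivWithinAt) ha (fun x _ => hvK x) b ⟨hab, le_rfl⟩
  rcases le_total s t with h | h
  · exact forward hu hK hs h
  · have hneg : ∀ x, HasDerivAt (fun r => u (-r)) (-u' (-x)) x := fun x => by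
      simpa [Function.comp_def] using (hu (-x)).comp x (hasDerivAt_neg x)
    simpa using forward (a := -s) (b := -t) hneg (fun x => by simpa using hK (-x))
      (by simpa using hs) (neg_le_neg h)

lemma abs_le_two_mul_of_sq_eq {p q : ℕ} (hq : 2 ≤ q) {a d : ℝ} (ha : a ∈ Set.Icc (0 : ℝ) 1)
    (h : d ^ 2 = 4 * a ^ q * (1 - a) ^ p) : |d| ≤ 2 * |a| := by
  have h1 : a ^ q ≤ a ^ 2 := pow_le_pow_of_le_one ha.1 ha.2 hq
  have h2 : (1 - a) ^ p ≤ 1 := pow_le_one₀ (by linarith [ha.2]) (by linarith [ha.1])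
  have h3 : a ^ q * (1 - a) ^ p ≤ a ^ 2 :=
    (mul_le_of_le_one_right (pow_nonneg ha.1 q) h2).trans h1
  have h4 : |d| ≤ |2 * a| := sq_le_sq.mp (by nlinarith)
  simpa [abs_mul] using h4

lemma pos_of_sq_deriv_eq {p q : ℕ} (hq : 2 ≤ q) {y y' : ℝ → ℝ}
    (hy : ∀ t, HasDerivAt y (y' t) t) (hrange : ∀ t, y t ∈ Set.Icc (0 : ℝ) 1)
    (hen : ∀ t, (y' t) ^ 2 = 4 * (y t) ^ q * (1 - y t) ^ p)
    (hnc : ∃ s t, y s ≠ y t) (t : ℝ) : 0 < y t := by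
  refine (hrange t).1.lt_of_ne fun h => ?_
  have hz := eq_zero_of_hasDerivAt_of_abs_le_mul_abs hy
    (fun r => abs_le_two_mul_of_sq_eq hq (hrange r) (hen r)) h.symm
  obtain ⟨a, b, hab⟩ := hnc
  exact hab (by rw [hz a, hz b])

/-- If a function and its derivative both converge at infinity, the derivative tends to zero. -/
lemma eq_zero_of_tendsto_of_tendsto_deriv {y y' : ℝ → ℝ} {L c : ℝ}
    (hy : ∀ t, HasDerivAt y (y' t) t) (hL : Tendsto y atTop (nhds L))
    (hc : Tendsto y' atTop (nhds c)) : c = 0 := by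
  have hmv : ∀ t : ℝ, ∃ ξ ∈ Set.Ioo t (t + 1), y' ξ = y (t + 1) - y t := fun t => by
    obtain ⟨ξ, hξ, h⟩ := exists_hasDerivAt_eq_slope y y' (lt_add_one t)
      (fun x _ => (hy x).continuousAt.continuousWithinAt) (fun x _ => hy x)
    exact ⟨ξ, hξ, by simpa using h⟩
  choose ξ hξ h using hmv
  have hξt : Tendsto ξ atTop atTop := tendsto_atTop_mono (fun t => (hξ t).1.le) tendsto_id
  have h1 : Tendsto (fun t => y (t + 1) - y t) atTop (nhds (L - L)) :=
    (hL.comp (tendsto_atTop_add_const_right _ 1 tendsto_id)).sub hL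
  rw [sub_self] at h1
  exact tendsto_nhds_unique ((hc.comp hξt).congr h) h1

lemma tendsto_one_of_deriv_pos {p q : ℕ} {y y' : ℝ → ℝ}
    (hy : ∀ t, HasDerivAt y (y' t) t) (hrange : ∀ t, y t ∈ Set.Ioo (0 : ℝ) 1)
    (hen : ∀ t, (y' t) ^ 2 = 4 * (y t) ^ q * (1 - y t) ^ p) (hpos : ∀ t, 0 < y' t) :
    Tendsto y atTop (nhds 1) := by
  have hmono : StrictMono y := strictMono_of_hasDerivAt_pos hy hpos
  have hbdd : BddAbove (Set.range y) := ⟨1, by rintro _ ⟨t, rfl⟩; exact (hrange t).2.le⟩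
  have hL := tendsto_atTop_ciSup hmono.monotone hbdd
  have hL0 : 0 < ⨆ t, y t := (hrange 0).1.trans_le (le_ciSup hbdd 0)
  generalize (⨆ t, y t) = L at hL hL0
  have hcont : Continuous fun x : ℝ => √(4 * x ^ q * (1 - x) ^ p) := by fun_prop
  have hd : Tendsto y' atTop (nhds √(4 * L ^ q * (1 - L) ^ p)) :=
    ((hcont.tendsto L).comp hL).congr fun t => by
      simp only [Function.comp_apply, ← hen t, Real.sqrt_sq (hpos t).le]
  have hL1 : L ≤ 1 := le_of_tendsto' hL fun t => (hrange t).2.le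
  rcases hL1.eq_or_lt with rfl | hlt
  · exact hL
  · have h0 := eq_zero_of_tendsto_of_tendsto_deriv hy hL hd
    have : 0 < 1 - L := sub_pos.mpr hlt
    exact absurd h0 (by positivity)

lemma strictMono_and_tendsto_of_deriv_pos {p q : ℕ} {y y' : ℝ → ℝ}
    (hy : ∀ t, HasDerivAt y (y' t) t) (hrange : ∀ t, y t ∈ Set.Ioo (0 : ℝ) 1)
    (hen : ∀ t, (y' t) ^ 2 = 4 * (y t) ^ q * (1 - y t) ^ p) (hpos : ∀ t, 0 < y' t) :
    StrictMono y ∧ Tendsto y atBot (nhds 0) ∧ Tendsto y atTop (nhds 1) := by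
  refine ⟨strictMono_of_hasDerivAt_pos hy hpos, ?_, tendsto_one_of_deriv_pos hy hrange hen hpos⟩
  have h : Tendsto (fun t => 1 - y (-t)) atTop (nhds 1) :=
    tendsto_one_of_deriv_pos (p := q) (q := p) (y' := fun t => y' (-t))
      (fun t => by simpa using ((hy (-t)).comp t (hasDerivAt_neg t)).const_sub 1)
      (fun t => ⟨sub_pos.mpr (hrange _).2, sub_lt_self _ (hrange _).1⟩)
      (fun t => by rw [hen, sub_sub_cancel]; ring) (fun t => hpos _)
  simpa [Function.comp_def] using (h.const_sub 1).comp tendsto_neg_atBot_atTop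

/-- For `p, q ≥ 2`, a nonconstant solution of `y'² = 4 y^q (1-y)^p` with values in `[0,1]`
stays in `(0,1)`, is strictly monotone, and tends to `0` and `1` at the two ends. -/
theorem stmt_8 (p q : ℕ) (hp : 2 ≤ p) (hq : 2 ≤ q)
    (y y' : ℝ → ℝ)
    (hy : ∀ t, HasDerivAt y (y' t) t)
    (hrange : ∀ t, y t ∈ Set.Icc (0 : ℝ) 1)
    (hen : ∀ t, (y' t) ^ 2 = 4 * (y t) ^ q * (1 - y t) ^ p)
    (hnc : ∃ s t, y s ≠ y t) :
    (∀ t, y t ∈ Set.Ioo (0 : ℝ) 1) ∧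
    (StrictMono y ∨ StrictAnti y) ∧
    ((StrictAnti y ∧ Tendsto y atBot (nhds 1) ∧ Tendsto y atTop (nhds 0)) ∨
      (StrictMono y ∧ Tendsto y atBot (nhds 0) ∧ Tendsto y atTop (nhds 1))) := by
  have hlow := pos_of_sq_deriv_eq hq hy hrange hen hnc
  have hupp := pos_of_sq_deriv_eq (p := q) hp (y := fun t => 1 - y t) (y' := fun t => -y' t)
    (fun t => (hy t).const_sub 1)
    (fun t => ⟨sub_nonneg.mpr (hrange t).2, sub_le_self _ (hrange t).1⟩)
    (fun t => by rw [neg_sq, hen, sub_sub_cancel]; ring)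
    (by simpa using hnc)
  have hIoo : ∀ t, y t ∈ Set.Ioo (0 : ℝ) 1 := fun t => ⟨hlow t, sub_pos.mp (hupp t)⟩
  have hne : ∀ t, y' t ≠ 0 := fun t h => by
    have h1 := hen t
    have h2 := hlow t
    have h3 : 0 < 1 - y t := hupp t
    rw [h, zero_pow two_ne_zero] at h1
    exact absurd h1.symm (by positivity)
  refine ⟨hIoo, ?_⟩
  rcases hasDerivWithinAt_forall_lt_or_forall_gt_of_forall_ne convex_univ
    (fun t _ => (hy t).hasDerivWithinAt) (fun t _ => hne t) with h | h
  · obtain ⟨hm, hbot, htop⟩ := strictMono_and_tendsto_of_deriv_pos (p := p) (q := q)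
      (y := fun t => y (-t)) (y' := fun t => -y' (-t))
      (fun t => by simpa [Function.comp_def] using (hy (-t)).comp t (hasDerivAt_neg t))
      (fun t => hIoo _)
      (fun t => by rw [neg_sq, hen]) (fun t => neg_pos.mpr (h _ trivial))
    have ha : StrictAnti y := fun a b hab => by simpa using hm (neg_lt_neg hab)
    exact ⟨.inr ha, .inl ⟨ha,
      by simpa [Function.comp_def] using htop.comp tendsto_neg_atBot_atTop,
      by simpa [Function.comp_def] using hbot.comp tendsto_neg_atTop_atBot⟩⟩
  · have hm := strictMono_and_tendsto_of_deriv_pos hy hIoo hen fun t => h t trivial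
    exact ⟨.inl hm.1, .inr hm⟩
end

section
/- Let p = q ≥ 2, n = 2p, and let τ ∈ ℝ with |τ| ≤ τ_max. Suppose y : ℝ → ℝ is twice differentiable with y″(t) = 2·y(t)^(p−1)·(1 − y(t))^(p−1)·(p − 2p·y(t)) for all t, y(0) = 1/2, and y′(0) = −4·√(τ_max² − τ²). Then y(−t) = 1 − y(t) for all t ∈ ℝ. Consequently, for 0 < |τ| < τ_max the two roots y_min < y_max of y^p·(1−y)^p = 4τ² in [0,1] satisfy y_min + y_max = 1. -/
open Set in
/-- Global integral curves of a locally Lipschitz autonomous vector field that agree at one time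
agree at all times. -/
theorem LocallyLipschitz.integralCurve_unique {E : Type*} [NormedAddCommGroup E] [NormedSpace ℝ E]
    {v : E → E} (hv : LocallyLipschitz v) {f g : ℝ → E} {t₀ : ℝ}
    (hf : ∀ t, HasDerivAt f (v (f t)) t) (hg : ∀ t, HasDerivAt g (v (g t)) t)
    (heq : f t₀ = g t₀) : f = g := by
  ext t
  obtain ⟨a, b, ht, ht₀⟩ : ∃ a b, t ∈ Ioo a b ∧ t₀ ∈ Ioo a b := by
    use min t t₀ - 1, max t t₀ + 1
    grind
  have hcf : Continuous f := continuous_iff_continuousAt.2 fun s ↦ (hf s).continuousAt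
  have hcg : Continuous g := continuous_iff_continuousAt.2 fun s ↦ (hg s).continuousAt
  obtain ⟨K, hK⟩ := (hv.locallyLipschitzOn (s := f '' Icc a b ∪ g '' Icc a b)
    ).exists_lipschitzOnWith_of_compact
      ((isCompact_Icc.image hcf).union (isCompact_Icc.image hcg))
  exact ODE_solution_unique_of_mem_Ioo (v := fun _ ↦ v) (fun _ _ ↦ hK) ht₀
    (fun s hs ↦ ⟨hf s, .inl (mem_image_of_mem f (Ioo_subset_Icc_self hs))⟩)
    (fun s hs ↦ ⟨hg s, .inr (mem_image_of_mem g (Ioo_subset_Icc_self hs))⟩) heq ht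

/-- Let `g` be a `C¹` function with `g (1 - x) = -g x`. A solution of `y'' = g y` starting at `1 / 2`
satisfies `y (-t) = 1 - y t`. -/
theorem secondOrderODE_reflection {g y y' : ℝ → ℝ} (hg : ContDiff ℝ 1 g)
    (hodd : ∀ x, g (1 - x) = -g x) (hy : ∀ t, HasDerivAt y (y' t) t)
    (hy' : ∀ t, HasDerivAt y' (g (y t)) t) (h0 : y 0 = 1 / 2) (t : ℝ) :
    y (-t) = 1 - y t := by
  have hv : LocallyLipschitz fun z : ℝ × ℝ ↦ (z.2, g z.1) :=
    ContDiff.locallyLipschitz (𝕂 := ℝ) (by fun_prop)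
  have hreflected : ∀ s, HasDerivAt (fun s ↦ (1 - y (-s), y' (-s))) (y' (-s), g (1 - y (-s))) s := by
    intro s
    refine HasDerivAt.prodMk ?_ ?_
    · simpa using ((hy (-s)).comp s (hasDerivAt_neg s)).const_sub 1
    · simpa [hodd, Function.comp_def] using (hy' (-s)).comp s (hasDerivAt_neg s)
  have hcurves := hv.integralCurve_unique (t₀ := 0) (fun s ↦ (hy s).prodMk (hy' s)) hreflected
    (by norm_num [h0])
  have := congrArg Prod.fst (congrFun hcurves t)
  simp only at this
  linarith

/-- Two distinct points of `[0, 1]` at which `x ^ p * (1 - x) ^ p` agrees sum to `1`. -/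
theorem add_eq_one_of_pow_mul_one_sub_pow_eq {p : ℕ} (hp : p ≠ 0) {a b : ℝ}
    (ha : a ∈ Set.Icc (0 : ℝ) 1) (hb : b ∈ Set.Icc (0 : ℝ) 1) (hab : a ≠ b)
    (h : a ^ p * (1 - a) ^ p = b ^ p * (1 - b) ^ p) : a + b = 1 := by
  rw [← mul_pow, ← mul_pow] at h
  have h' : a * (1 - a) = b * (1 - b) :=
    (pow_left_inj₀ (mul_nonneg ha.1 (sub_nonneg.2 ha.2))
      (mul_nonneg hb.1 (sub_nonneg.2 hb.2)) hp).1 h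
  have : (a - b) * (1 - (a + b)) = 0 := by linear_combination h'
  rcases mul_eq_zero.1 this with h | h
  · exact absurd (sub_eq_zero.1 h) hab
  · linarith


/-- For `p = q ≥ 2`: the normalized solution of `y'' = 2 f'(y)` satisfies the reflection
symmetry `y(-t) = 1 - y(t)`, and consequently the two roots of `y^p (1-y)^p = 4τ²`
in `[0,1]` sum to `1`. -/
theorem stmt_11 (p : ℕ) (hp : 2 ≤ p) (τ : ℝ)
    (hτ : |τ| ≤ Real.sqrt ((p : ℝ) ^ p * (p : ℝ) ^ p / (2 * (p : ℝ)) ^ (2 * p)) / 2)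
    (y y' y'' : ℝ → ℝ)
    (hy : ∀ t, HasDerivAt y (y' t) t)
    (hy' : ∀ t, HasDerivAt y' (y'' t) t)
    (hode : ∀ t, y'' t =
      2 * (y t) ^ (p - 1) * (1 - y t) ^ (p - 1) * ((p : ℝ) - 2 * (p : ℝ) * y t))
    (h0 : y 0 = 1 / 2)
    (h0' : y' 0 = -4 * Real.sqrt
      ((Real.sqrt ((p : ℝ) ^ p * (p : ℝ) ^ p / (2 * (p : ℝ)) ^ (2 * p)) / 2) ^ 2 - τ ^ 2)) :
    (∀ t, y (-t) = 1 - y t) ∧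
    (0 < |τ| → |τ| < Real.sqrt ((p : ℝ) ^ p * (p : ℝ) ^ p / (2 * (p : ℝ)) ^ (2 * p)) / 2 →
      ∀ ymin ymax : ℝ, ymin ∈ Set.Icc (0 : ℝ) 1 → ymax ∈ Set.Icc (0 : ℝ) 1 →
        ymin ^ p * (1 - ymin) ^ p = 4 * τ ^ 2 → ymax ^ p * (1 - ymax) ^ p = 4 * τ ^ 2 →
        ymin < ymax → ymin + ymax = 1) := by
  refine ⟨secondOrderODE_reflection
    (g := fun x ↦ 2 * x ^ (p - 1) * (1 - x) ^ (p - 1) * ((p : ℝ) - 2 * (p : ℝ) * x))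
    (by fun_prop) (fun x ↦ ?_) hy (fun t ↦ hode t ▸ hy' t) h0, ?_⟩
  · simp only [sub_sub_cancel]
    ring
  · intro _ _ a b ha hb hfa hfb hab
    exact add_eq_one_of_pow_mul_one_sub_pow_eq (by omega) ha hb hab.ne (hfa.trans hfb.symm)
end
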